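/- Fix an integer t ≥ 2 and let q ∈ ℂ with |q| < 1. Let M_∞(q) be the infinite matrix with entries (M_∞(q))_{r,s} = q^r·[r ≤ t·s] for r, s ≥ 1, and define det(I − M_∞(q)) as the limit as N → ∞ of the principal N×N minors det(δ_{rs} − q^r [r ≤ ts])_{1≤r,s≤N} (which converges for |q| < 1). Then det(I − M_∞(q)) = 1 − b(q,1,1,1), where b(q,1,1,1) = Σ_{j≥1} (−1)^{j−1} ∏_{i=1}^{j} q^{h_i}/(1−q^{h_i}). -/

import Mathlib

open scoped BigOperators
open Filter MeasureTheory

noncomputable section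

/-- `hp t j = 1 + t + ⋯ + t^(j-1) = (t^j - 1)/(t-1)`. -/
def hp (t j : ℕ) : ℕ := ∑ i ∈ Finset.range j, t ^ i

/-- The series `b(q,u,v,w)`
`b = Σ_{j≥1} v q^{h_j} u^{t^j} w^j/(1−q^{h_j} u^{t^j}) ∏_{i=1}^{j−1} (1−v−q^{h_i}u^{t^i})/(1−q^{h_i}u^{t^i})`. -/
def bGF (t : ℕ) (q u v w : ℂ) : ℂ :=
  ∑' j : ℕ,
    v * q ^ hp t (j + 1) * u ^ t ^ (j + 1) * w ^ (j + 1) /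
        (1 - q ^ hp t (j + 1) * u ^ t ^ (j + 1)) *
      ∏ i ∈ Finset.Icc 1 j,
        (1 - v - q ^ hp t i * u ^ t ^ i) / (1 - q ^ hp t i * u ^ t ^ i)

/-- The series `a(q,u,v,w)` (for canonical forests with `r` roots)
`a = Σ_{j≥0} v q^{r h_j} u^{r t^j} w^j ∏_{i=1}^{j} (1−v−q^{h_i}u^{t^i})/(1−q^{h_i}u^{t^i})`. -/
def aGF (t r : ℕ) (q u v w : ℂ) : ℂ :=
  ∑' j : ℕ,
    v * q ^ (r * hp t j) * u ^ (r * t ^ j) * w ^ j *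
      ∏ i ∈ Finset.Icc 1 j,
        (1 - v - q ^ hp t i * u ^ t ^ i) / (1 - q ^ hp t i * u ^ t ^ i)

/-- A canonical `t`-ary forest with `r` (ordered) roots, encoded by its sequence of
numbers of internal vertices on each level (a canonical forest is uniquely determined
by this sequence: on each level the leaves come first, since outdegrees read from left
to right are non-decreasing).  The number `c_0` of internal vertices on level `0` is at
most `r`, each level's internal-vertex count satisfies `1 ≤ c_{k+1} ≤ t·c_k`, and the
list stops at the last level containing internal vertices. -/
structure CanonicalForest (t r : ℕ) where
  levels : List ℕ
  pos : ∀ c ∈ levels, 0 < c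
  head_le : ∀ c ∈ levels.head?, c ≤ r
  chain : levels.Chain' fun a b => b ≤ t * a

namespace CanonicalForest

variable {t r : ℕ} (T : CanonicalForest t r)

/-- the number `n(T)` of internal vertices -/
def size : ℕ := T.levels.sum

/-- the height `h(T)`: the maximal distance of a leaf from the root level -/
def height : ℕ := T.levels.length

/-- the number of internal vertices at depth `k` -/
def internAt (k : ℕ) : ℕ := T.levels.getD k 0

/-- the number of vertices at depth `k` -/
def vertsAt (k : ℕ) : ℕ := if k = 0 then r else t * T.internAt (k - 1)

/-- the number of leaves at depth `k` -/
def leavesAt (k : ℕ) : ℕ := T.vertsAt k - T.internAt k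

/-- the number `m(T)` of leaves at maximal depth -/
def lastLeaves : ℕ := T.vertsAt T.height

/-- the number `d(T)` of distinct depths at which leaves occur -/
def distinctDepths : ℕ :=
  ((Finset.range (T.height + 1)).filter fun k => 0 < T.leavesAt k).card

/-- the (leaf-)width `w(T)`: the maximal number of leaves on one level -/
def width : ℕ := (Finset.range (T.height + 1)).sup fun k => T.leavesAt k

/-- the total path length `ℓ(T)`: the sum of the depths of all vertices -/
def pathLength : ℕ := ∑ k ∈ Finset.range (T.height + 1), k * T.vertsAt k

end CanonicalForest

/-- the number of canonical `t`-ary forests with `r` roots and `n` internal vertices -/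
def forestCount (t r n : ℕ) : ℕ := Nat.card {T : CanonicalForest t r // T.size = n}

/-- the probability of an event under the uniform distribution on canonical `t`-ary
forests with `r` roots and `n` internal vertices -/
def forestProb (t r n : ℕ) (s : Set (CanonicalForest t r)) : ℝ :=
  (Nat.card {T : CanonicalForest t r // T.size = n ∧ T ∈ s} : ℝ) / forestCount t r n

/-- the expectation of a random variable under the uniform distribution on canonical
`t`-ary forests with `r` roots and `n` internal vertices -/
def forestExp (t r n : ℕ) (f : CanonicalForest t r → ℝ) : ℝ :=
  (∑ᶠ T : {T : CanonicalForest t r // T.size = n}, f T.1) / forestCount t r n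

/-- the variance of a random variable under the uniform distribution on canonical
`t`-ary forests with `r` roots and `n` internal vertices -/
def forestVar (t r n : ℕ) (f : CanonicalForest t r → ℝ) : ℝ :=
  forestExp t r n (fun T => f T ^ 2) - forestExp t r n f ^ 2

/-- the distribution function of the standard normal distribution -/
def stdGaussCDF (x : ℝ) : ℝ :=
  (Real.sqrt (2 * Real.pi))⁻¹ * ∫ u in Set.Iic x, Real.exp (-u ^ 2 / 2)

/-- the density of the standard normal distribution -/
def stdGaussPDF (x : ℝ) : ℝ :=
  (Real.sqrt (2 * Real.pi))⁻¹ * Real.exp (-x ^ 2 / 2)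


/-- The principal minors. -/
def minorDet (t : ℕ) (q : ℂ) (N : ℕ) : ℂ :=
  Matrix.det (Matrix.of fun r s : Fin N =>
        (if r = s then (1 : ℂ) else 0)
          - q ^ ((r : ℕ) + 1) * (if (r : ℕ) + 1 ≤ t * ((s : ℕ) + 1) then 1 else 0))

lemma minorDet_block (t : ℕ) (q : ℂ) (n k : ℕ) (hk : k ≤ n) (C : Matrix (Fin n) (Fin n) ℂ)
    (h0 : ∀ r s : Fin n, (r : ℕ) < k → k ≤ (s : ℕ) → C r s = 0)
    (hTL : ∀ r s : Fin n, (r : ℕ) < k → (s : ℕ) < k → C r s = (if r = s then (1 : ℂ) else 0)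
          - q ^ ((r : ℕ) + 1) * (if (r : ℕ) + 1 ≤ t * ((s : ℕ) + 1) then 1 else 0))
    (hBR : ∀ r s : Fin n, k ≤ (r : ℕ) → r < s → C r s = 0)
    (hD : ∀ r : Fin n, k ≤ (r : ℕ) → C r r = 1) :
    C.det = minorDet t q k := by
  rw [Matrix.twoBlockTriangular_det' C (fun i => (i : ℕ) < k)
    (fun i hi j hj => h0 i j hi (not_lt.mp hj))]
  have e2 : (Matrix.toSquareBlockProp C fun i => ¬ ((i : ℕ) < k)).det = 1 := by
    rw [Matrix.det_of_lowerTriangular]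
    · apply Finset.prod_eq_one
      intro i _
      exact hD i.1 (not_lt.mp i.2)
    · intro i j hij
      exact hBR i.1 j.1 (not_lt.mp i.2) (by simpa using hij)
  rw [e2, mul_one, minorDet]
  let e : Fin k ≃ {i : Fin n // (i : ℕ) < k} :=
    { toFun := fun i => ⟨⟨i, i.2.trans_le hk⟩, i.2⟩
      invFun := fun i => ⟨i.1, i.2⟩
      left_inv := fun i => rfl
      right_inv := fun i => rfl }
  rw [← Matrix.det_submatrix_equiv_self e]
  congr 1
  ext r s
  have := hTL (e r).1 (e s).1 (e r).2 (e s).2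
  simp only [Matrix.submatrix_apply, Matrix.toSquareBlockProp_def, Matrix.of_apply, this]
  simp [e, Fin.ext_iff]

lemma minorDet_succ (t : ℕ) (ht : 2 ≤ t) (q : ℂ) (N : ℕ) :
    minorDet t q (N + 1) = minorDet t q N - q ^ (N + 1) * minorDet t q (N / t) := by
  have hdiv : ∀ r s : ℕ, (r + 1 ≤ t * (s + 1)) ↔ r / t ≤ s := by
    intro r s
    rw [← Nat.lt_succ_iff (n := s), Nat.div_lt_iff_lt_mul (by omega), Nat.succ_le_iff, mul_comm]
  let A : Matrix (Fin (N + 1)) (Fin (N + 1)) ℂ := Matrix.of fun r s =>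
        (if r = s then (1 : ℂ) else 0)
          - q ^ ((r : ℕ) + 1) * (if (r : ℕ) + 1 ≤ t * ((s : ℕ) + 1) then 1 else 0)
  let e : Fin (N + 1) → ℂ := fun s => if Fin.last N = s then 1 else 0
  let v : Fin (N + 1) → ℂ := fun s => if N / t ≤ (s : ℕ) then 1 else 0
  have hA : A = A.updateRow (Fin.last N) (e + (-q ^ (N + 1)) • v) := by
    ext r s
    rw [Matrix.updateRow_apply]
    split_ifs with h
    · subst h
      simp [A, e, v, hdiv]
      split_ifs <;> ring
    · rfl
  have h1 : (A.updateRow (Fin.last N) e).det = minorDet t q N := by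
    -- expand along the last row, which is a unit vector
    rw [Matrix.det_succ_row _ (Fin.last N), Finset.sum_eq_single (Fin.last N)]
    · simp only [Matrix.updateRow_self, e, if_true, mul_one, minorDet]
      rw [← two_mul, pow_mul]
      simp only [even_two, Even.neg_pow, one_pow, one_mul]
      congr 1
      ext r s
      simp [A, Matrix.updateRow_apply, Fin.ext_iff, (r.2).ne]
    · intro b _ hb
      simp [e, hb.symm]
    · simp
  have h2 : (A.updateRow (Fin.last N) v).det = minorDet t q (N / t) := by
    rw [← Matrix.det_eq_of_forall_row_eq_smul_add_const
      (A := Matrix.of fun r s => A.updateRow (Fin.last N) v r s +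
        (if r = Fin.last N then 0 else q ^ ((r : ℕ) + 1)) * A.updateRow (Fin.last N) v (Fin.last N) s)
      (fun r => if r = Fin.last N then 0 else q ^ ((r : ℕ) + 1)) (Fin.last N) (by simp)
      (fun i j => rfl)]
    have hle : N / t ≤ N := Nat.div_le_self _ _
    have hlt : ∀ r : Fin (N + 1), r ≠ Fin.last N → (r : ℕ) / t ≤ N / t := fun r _ =>
      Nat.div_le_div_right (Nat.lt_succ_iff.mp r.2)
    have hN : N / t < N ∨ N = 0 := by
      rcases Nat.eq_zero_or_pos N with h | h
      · exact Or.inr h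
      · exact Or.inl (Nat.div_lt_self h (by omega))
    apply minorDet_block t q (N + 1) (N / t) (by omega)
    · intro r s hr hs
      have hrl : r ≠ Fin.last N := by
        rintro rfl; simp at hr; omega
      have := hlt r hrl
      have hrs : r ≠ s := by rintro rfl; omega
      simp [Matrix.updateRow_apply, hrl, A, v, hdiv, hs, this.trans hs, hrs]
    · intro r s hr hs
      have hrl : r ≠ Fin.last N := by
        rintro rfl; simp at hr; omega
      simp [Matrix.updateRow_apply, hrl, A, v, not_le.mpr hs]
    · intro r s hr hs
      have hrl : r ≠ Fin.last N := by
        rintro rfl; exact absurd (Fin.le_last s) (not_le.mpr hs)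
      have := hlt r hrl
      have hs' : N / t ≤ (s : ℕ) := hr.trans (le_of_lt hs)
      simp [Matrix.updateRow_apply, hrl, A, v, hdiv, hs', this.trans hs', hs.ne]
    · intro r hr
      by_cases hrl : r = Fin.last N
      · subst hrl
        simp [v, hle]
      · have := hlt r hrl
        simp [Matrix.updateRow_apply, hrl, A, v, hdiv, hr, this.trans hr]
  change A.det = _
  rw [hA, Matrix.det_updateRow_add, Matrix.det_updateRow_smul, h1, h2]
  ring

lemma minorDet_zero (t : ℕ) (q : ℂ) : minorDet t q 0 = 1 := by
  simp [minorDet]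

lemma minorDet_bound (t : ℕ) (ht : 2 ≤ t) (q : ℂ) (hq : ‖q‖ < 1) :
    ∃ C : ℝ, ∀ N, ‖minorDet t q N‖ ≤ C := by
  have hB : ∀ N, ∀ M ≤ N, ‖minorDet t q M‖ ≤
      Real.exp (∑ i ∈ Finset.range N, ‖q‖ ^ (i + 1)) := by
    intro N
    induction N with
    | zero =>
      intro M hM
      obtain rfl : M = 0 := by omega
      simp [minorDet_zero]
    | succ N ih =>
      intro M hM
      have hmono : Real.exp (∑ i ∈ Finset.range N, ‖q‖ ^ (i + 1)) ≤
          Real.exp (∑ i ∈ Finset.range (N + 1), ‖q‖ ^ (i + 1)) := by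
        rw [Finset.sum_range_succ]
        apply Real.exp_le_exp.mpr
        have : 0 ≤ ‖q‖ ^ (N + 1) := by positivity
        linarith
      rcases Nat.lt_or_ge N M with h | h
      · obtain rfl : M = N + 1 := by omega
        rw [minorDet_succ t ht, Finset.sum_range_succ, Real.exp_add]
        have h1 := ih N le_rfl
        have h2 := ih (N / t) (Nat.div_le_self _ _)
        have h3 := Real.add_one_le_exp (‖q‖ ^ (N + 1))
        have h4 : 0 ≤ ‖q‖ ^ (N + 1) := by positivity
        set E := Real.exp (∑ i ∈ Finset.range N, ‖q‖ ^ (i + 1)) with hE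
        have hE0 : 0 ≤ E := (Real.exp_pos _).le
        calc _ ≤ ‖minorDet t q N‖ + ‖q ^ (N + 1) * minorDet t q (N / t)‖ := norm_sub_le _ _
          _ ≤ E + ‖q‖ ^ (N + 1) * E := by
            rw [norm_mul, norm_pow]; gcongr
          _ = E * (‖q‖ ^ (N + 1) + 1) := by ring
          _ ≤ _ := by gcongr
      · exact (ih M h).trans hmono
  have hs : Summable fun i : ℕ => ‖q‖ ^ (i + 1) :=
    (summable_nat_add_iff 1).mpr (summable_geometric_of_lt_one (norm_nonneg _) hq)
  refine ⟨Real.exp (∑' i : ℕ, ‖q‖ ^ (i + 1)), fun N => (hB N N le_rfl).trans ?_⟩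
  exact Real.exp_le_exp.mpr (hs.sum_le_tsum _ (fun i _ => by positivity))

/-- auxiliary series -/
def Hser (t : ℕ) (q y : ℂ) : ℂ := ∑' N : ℕ, y ^ (N + 1) * minorDet t q (N / t)

lemma norm_term_le {C : ℝ} (t : ℕ) (q y : ℂ)
    (hC : ∀ N, ‖minorDet t q N‖ ≤ C) (N : ℕ) :
    ‖y ^ (N + 1) * minorDet t q (N / t)‖ ≤ (‖y‖ * C) * ‖y‖ ^ N := by
  rw [norm_mul, norm_pow, pow_succ]
  have := hC (N / t)
  have h4 : 0 ≤ ‖y‖ ^ N * ‖y‖ := by positivity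
  nlinarith [mul_le_mul_of_nonneg_left this h4]

lemma Hser_summable (t : ℕ) (ht : 2 ≤ t) (q : ℂ) (hq : ‖q‖ < 1) (y : ℂ) (hy : ‖y‖ < 1) :
    Summable fun N : ℕ => y ^ (N + 1) * minorDet t q (N / t) := by
  obtain ⟨C, hC⟩ := minorDet_bound t ht q hq
  exact .of_norm_bounded ((summable_geometric_of_lt_one (norm_nonneg _) hy).mul_left _)
    (norm_term_le t q y hC)

lemma Hser_bound (t : ℕ) (ht : 2 ≤ t) (q : ℂ) (hq : ‖q‖ < 1) :
    ∃ B : ℝ, ∀ y : ℂ, ‖y‖ ≤ ‖q‖ → ‖Hser t q y‖ ≤ B := by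
  obtain ⟨C, hC⟩ := minorDet_bound t ht q hq
  have hC0 : 0 ≤ C := (norm_nonneg _).trans (hC 0)
  refine ⟨(‖q‖ * C) * (1 - ‖q‖)⁻¹, fun y hy => ?_⟩
  apply tsum_of_norm_bounded ((hasSum_geometric_of_lt_one (norm_nonneg q) hq).mul_left _)
  intro N
  refine (norm_term_le t q y hC N).trans ?_
  gcongr

lemma Hser_fun (t : ℕ) (ht : 2 ≤ t) (q : ℂ) (hq : ‖q‖ < 1) (y : ℂ) (hy : ‖y‖ < 1) :
    Hser t q y = y / (1 - y) * (1 - Hser t q (q * y ^ t)) := by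
  have hyt : ‖y ^ t‖ < 1 := by
    rw [norm_pow]; exact pow_lt_one₀ (norm_nonneg _) hy (by omega)
  have hy1 : 1 - y ≠ 0 := by
    intro h
    have : y = 1 := (sub_eq_zero.mp h).symm
    rw [this] at hy; simp at hy
  have hqy : ‖q * y ^ t‖ < 1 := by
    rw [norm_mul]
    nlinarith [norm_nonneg q, norm_nonneg (y ^ t)]
  have hs := Hser_summable t ht q hq y hy
  have hs2 := Hser_summable t ht q hq _ hqy
  obtain ⟨C, hC⟩ := minorDet_bound t ht q hq
  have hE : Summable fun m : ℕ => minorDet t q m * (y ^ t) ^ m := by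
    refine .of_norm_bounded ((summable_geometric_of_lt_one (norm_nonneg _) hyt).mul_left C) ?_
    intro m
    rw [norm_mul, norm_pow]
    have := hC m
    gcongr
  -- regroup by residues
  have : NeZero t := ⟨by omega⟩
  have hA : Hser t q y = (y * ∑ k ∈ Finset.range t, y ^ k) * ∑' m : ℕ, minorDet t q m * (y ^ t) ^ m := by
    rw [Hser, ← (Nat.divModEquiv t).symm.tsum_eq, Summable.tsum_prod]
    · rw [← tsum_mul_left]
      apply tsum_congr
      intro m
      rw [tsum_fintype, ← Fin.sum_univ_eq_sum_range (fun k => y ^ k), Finset.mul_sum, Finset.sum_mul]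
      apply Finset.sum_congr rfl
      intro k _
      have : (m * t + (k : ℕ)) / t = m := by
        rw [Nat.add_comm, Nat.add_mul_div_right _ _ (by omega), Nat.div_eq_of_lt k.2, zero_add]
      simp only [Nat.divModEquiv_symm_apply, this]
      ring
    · have := ((Nat.divModEquiv t).symm.summable_iff
        (f := fun N : ℕ => y ^ (N + 1) * minorDet t q (N / t))).mpr hs
      simpa only [Function.comp_def] using this
  have hB : (1 - y ^ t) * ∑' m : ℕ, minorDet t q m * (y ^ t) ^ m = 1 - Hser t q (q * y ^ t) := by
    have h1 := hE.tsum_eq_zero_add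
    have h2 : ∑' m : ℕ, minorDet t q (m + 1) * (y ^ t) ^ (m + 1) =
        y ^ t * (∑' m : ℕ, minorDet t q m * (y ^ t) ^ m) - Hser t q (q * y ^ t) := by
      rw [Hser, ← tsum_mul_left, ← (hE.mul_left _).tsum_sub hs2]
      apply tsum_congr
      intro m
      rw [minorDet_succ t ht]
      ring
    rw [h2, minorDet_zero] at h1
    simp only [pow_zero, mul_one] at h1
    linear_combination h1
  have hg : (∑ k ∈ Finset.range t, y ^ k) * (1 - y) = 1 - y ^ t := by
    have := geom_sum_mul y t
    linear_combination -this
  rw [← hB, hA, ← hg]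
  field_simp

lemma tendsto_minorDet (t : ℕ) (ht : 2 ≤ t) (q : ℂ) (hq : ‖q‖ < 1) :
    Tendsto (minorDet t q) atTop (nhds (1 - Hser t q q)) := by
  have hs := (Hser_summable t ht q hq q hq).hasSum.tendsto_sum_nat
  have h : ∀ N, minorDet t q N = 1 - ∑ i ∈ Finset.range N, q ^ (i + 1) * minorDet t q (i / t) := by
    intro N
    induction N with
    | zero => simp [minorDet_zero]
    | succ N ih => rw [minorDet_succ t ht, Finset.sum_range_succ, ih]; ring
  have := hs.const_sub 1
  rw [funext h]
  exact this

lemma hp_succ (t j : ℕ) : hp t (j + 1) = 1 + t * hp t j := by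
  simp only [hp, Finset.sum_range_succ', Finset.mul_sum, pow_succ]
  simp [add_comm, mul_comm]

lemma le_hp (t : ℕ) (ht : 2 ≤ t) (j : ℕ) : j ≤ hp t j := by
  induction j with
  | zero => simp
  | succ j ih => rw [hp_succ]; nlinarith

lemma Hser_iter (t : ℕ) (ht : 2 ≤ t) (q : ℂ) (hq : ‖q‖ < 1) (J : ℕ) :
    Hser t q q = ∑ j ∈ Finset.range J, (-1 : ℂ) ^ j *
        ∏ i ∈ Finset.Icc 1 (j + 1), q ^ hp t i / (1 - q ^ hp t i) +
      (-1 : ℂ) ^ J * (∏ i ∈ Finset.Icc 1 J, q ^ hp t i / (1 - q ^ hp t i)) *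
        Hser t q (q ^ hp t (J + 1)) := by
  induction J with
  | zero => simp [hp]
  | succ J ih =>
    have hy : ‖q ^ hp t (J + 1)‖ < 1 := by
      rw [norm_pow]
      exact pow_lt_one₀ (norm_nonneg _) hq (by have := le_hp t ht (J + 1); omega)
    have e : q * (q ^ hp t (J + 1)) ^ t = q ^ hp t (J + 1 + 1) := by
      rw [hp_succ t (J + 1), pow_add, pow_one, ← pow_mul, mul_comm t]
    rw [ih, Finset.sum_range_succ, Finset.prod_Icc_succ_top (by omega), Hser_fun t ht q hq _ hy, e]
    ring

lemma factor_tendsto (t : ℕ) (ht : 2 ≤ t) (q : ℂ) (hq : ‖q‖ < 1) :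
    Tendsto (fun i : ℕ => q ^ hp t i / (1 - q ^ hp t i)) atTop (nhds 0) := by
  have h1 : Tendsto (hp t) atTop atTop := tendsto_atTop_mono (le_hp t ht) tendsto_id
  have h2 : Tendsto (fun i : ℕ => q ^ hp t i) atTop (nhds 0) :=
    (tendsto_pow_atTop_nhds_zero_of_norm_lt_one hq).comp h1
  have := h2.div (h2.const_sub 1) (by simp)
  rw [zero_div] at this
  exact this

lemma series_summable (t : ℕ) (ht : 2 ≤ t) (q : ℂ) (hq : ‖q‖ < 1) :
    Summable fun j : ℕ => (-1 : ℂ) ^ j *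
        ∏ i ∈ Finset.Icc 1 j, q ^ hp t i / (1 - q ^ hp t i) := by
  apply summable_of_ratio_norm_eventually_le (r := 1 / 2) (by norm_num)
  have h := ((tendsto_add_atTop_iff_nat 1).mpr (factor_tendsto t ht q hq)).norm
  rw [norm_zero] at h
  filter_upwards [h.eventually (gt_mem_nhds (show (0 : ℝ) < 1 / 2 by norm_num))] with n hn
  rw [Finset.prod_Icc_succ_top (by omega)]
  simp only [norm_mul, norm_pow, norm_neg, norm_one, one_pow, one_mul]
  rw [mul_comm]
  gcongr

lemma Hser_eq (t : ℕ) (ht : 2 ≤ t) (q : ℂ) (hq : ‖q‖ < 1) :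
    Hser t q q = ∑' j : ℕ, (-1 : ℂ) ^ j *
        ∏ i ∈ Finset.Icc 1 (j + 1), q ^ hp t i / (1 - q ^ hp t i) := by
  have hs := series_summable t ht q hq
  have hs1 : Summable fun j : ℕ => (-1 : ℂ) ^ j *
        ∏ i ∈ Finset.Icc 1 (j + 1), q ^ hp t i / (1 - q ^ hp t i) := by
    have := ((summable_nat_add_iff 1).mpr hs).neg
    refine this.congr fun j => ?_
    rw [pow_succ]; ring
  obtain ⟨B, hB⟩ := Hser_bound t ht q hq
  have hz : Tendsto (fun J : ℕ => (-1 : ℂ) ^ J *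
      (∏ i ∈ Finset.Icc 1 J, q ^ hp t i / (1 - q ^ hp t i)) *
        Hser t q (q ^ hp t (J + 1))) atTop (nhds 0) := by
    have h0 := hs.tendsto_atTop_zero.norm.mul_const B
    rw [norm_zero, zero_mul] at h0
    refine squeeze_zero_norm (fun J => ?_) h0
    rw [norm_mul]
    refine mul_le_mul_of_nonneg_left (hB _ ?_) (norm_nonneg _)
    rw [norm_pow]
    refine pow_le_of_le_one (norm_nonneg _) hq.le ?_
    have := le_hp t ht (J + 1)
    omega
  have h := hs1.hasSum.tendsto_sum_nat.add hz
  rw [add_zero] at h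
  refine tendsto_nhds_unique ?_ h
  exact tendsto_const_nhds.congr fun J => Hser_iter t ht q hq J

/-- The infinite determinant `det(I − M_∞(q))`, defined as the limit
of the principal `N×N` minors of the infinite matrix `M_∞(q) = (q^r·[r ≤ t·s])_{r,s≥1}`,
equals `1 − b(q,1,1,1)` for `|q| < 1`, where
`b(q,1,1,1) = Σ_{j≥1} (−1)^{j−1} ∏_{i=1}^{j} q^{h_i}/(1−q^{h_i})`. -/
theorem infinite_determinant_eq (t : ℕ) (ht : 2 ≤ t) (q : ℂ) (hq : ‖q‖ < 1) :
    Filter.Tendsto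
      (fun N : ℕ => Matrix.det (Matrix.of fun r s : Fin N =>
        (if r = s then (1 : ℂ) else 0)
          - q ^ ((r : ℕ) + 1) * (if (r : ℕ) + 1 ≤ t * ((s : ℕ) + 1) then 1 else 0)))
      Filter.atTop
      (nhds (1 - ∑' j : ℕ, (-1 : ℂ) ^ j *
        ∏ i ∈ Finset.Icc 1 (j + 1), q ^ hp t i / (1 - q ^ hp t i))) := by
  rw [← Hser_eq t ht q hq]
  exact tendsto_minorDet t ht q hq

end
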